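/- Let n ≥ 3 and let g(x', x_n) = c(x', x_n)·blockdiag(ĝ(x'), 1) on ℝ^n as in the setup. Let u ∈ C²(ℝ^{n−1}) and set f(x', x_n) := x_n − u(x'). Then at every point x = (x', x_n) ∈ ℝ^n: c(x)²·(|∇_g f(x)|²_g Δ_g f(x) − (∇²_g f)(∇_g f, ∇_g f)(x)) = (−Δ_ĝ u(x') + ((1−n)/(2c(x))) Σ_{m,r=1}^{n−1} ĝ^{mr}(x') ∂_{x_r}c(x) ∂_{x_m}u(x') + ((n−1)/(2c(x))) ∂_{x_n}c(x))·(1 + |∇_ĝ u(x')|²_ĝ) + (∇²_ĝ u)(∇_ĝ u, ∇_ĝ u)(x'). Consequently, since c > 0, the graph of u over a domain Ω ⊂ ℝ^{n−1} is a minimal surface (i.e., |∇_g f|²_g Δ_g f − (∇²_g f)(∇_g f, ∇_g f) = 0 at every point (x', u(x')), x' ∈ Ω) if and only if u satisfies the minimal surface equation (−Δ_ĝ u + ((1−n)/(2c(x', u(x')))) ĝ^{mr} ∂_{x_r}c(x', u(x')) ∂_{x_m}u + ((n−1)/(2c(x', u(x')))) ∂_{x_n}c(x', u(x')))(1 + |∇_ĝ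 u|²_ĝ) + (∇²_ĝ u)(∇_ĝ u, ∇_ĝ u) = 0 for all x' ∈ Ω. -/

import Mathlib

noncomputable section

open scoped BigOperators

/-- Partial derivative `∂_i f` at `x`. -/
def pd {k : ℕ} {E : Type*} [NormedAddCommGroup E] [NormedSpace ℝ E]
    (i : Fin k) (f : (Fin k → ℝ) → E) (x : Fin k → ℝ) : E :=
  fderiv ℝ f x (Pi.single i 1)

/-- Christoffel symbols `Γ(h)^m_{ij} = ½ h^{ml}(∂_i h_{jl} + ∂_j h_{il} − ∂_l h_{ij})`. -/
def christoffel {k : ℕ} (h : (Fin k → ℝ) → Matrix (Fin k) (Fin k) ℝ)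
    (m i j : Fin k) (x : Fin k → ℝ) : ℝ :=
  (1 / 2) * ∑ l : Fin k, (h x)⁻¹ m l *
    (pd i (fun y => h y j l) x + pd j (fun y => h y i l) x - pd l (fun y => h y i j) x)

/-- Laplace–Beltrami operator `Δ_h f = h^{ij}(∂²_{ij} f − Γ(h)^m_{ij} ∂_m f)`. -/
def laplaceB {k : ℕ} (h : (Fin k → ℝ) → Matrix (Fin k) (Fin k) ℝ)
    (f : (Fin k → ℝ) → ℝ) (x : Fin k → ℝ) : ℝ :=
  ∑ i : Fin k, ∑ j : Fin k, (h x)⁻¹ i j *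
    (pd i (pd j f) x - ∑ l : Fin k, christoffel h l i j x * pd l f x)

/-- Hessian `(∇²_h f)_{ij} = ∂²_{ij} f − Γ(h)^m_{ij} ∂_m f`. -/
def hessian {k : ℕ} (h : (Fin k → ℝ) → Matrix (Fin k) (Fin k) ℝ)
    (f : (Fin k → ℝ) → ℝ) (i j : Fin k) (x : Fin k → ℝ) : ℝ :=
  pd i (pd j f) x - ∑ l : Fin k, christoffel h l i j x * pd l f x

/-- Gradient components `(∇_h f)^i = h^{ij} ∂_j f`. -/
def gradC {k : ℕ} (h : (Fin k → ℝ) → Matrix (Fin k) (Fin k) ℝ)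
    (f : (Fin k → ℝ) → ℝ) (i : Fin k) (x : Fin k → ℝ) : ℝ :=
  ∑ j : Fin k, (h x)⁻¹ i j * pd j f x

/-- Squared gradient norm `|∇_h f|²_h = h^{ij} ∂_i f ∂_j f`. -/
def gradSq {k : ℕ} (h : (Fin k → ℝ) → Matrix (Fin k) (Fin k) ℝ)
    (f : (Fin k → ℝ) → ℝ) (x : Fin k → ℝ) : ℝ :=
  ∑ i : Fin k, ∑ j : Fin k, (h x)⁻¹ i j * pd i f x * pd j f x

/-- Divergence `div_h a = Σ_i (∂_i a^i + Σ_j a^j Γ(h)^i_{ij})`. -/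
def divg {k : ℕ} (h : (Fin k → ℝ) → Matrix (Fin k) (Fin k) ℝ)
    (a : Fin k → (Fin k → ℝ) → ℝ) (x : Fin k → ℝ) : ℝ :=
  ∑ i : Fin k, (pd i (a i) x + ∑ j : Fin k, a j x * christoffel h i i j x)

/-- The projection `x ↦ x'` onto the first `m` coordinates. -/
def proj {m : ℕ} (x : Fin (m + 1) → ℝ) : Fin m → ℝ := x ∘ Fin.castSucc

/-- The metric `g(x', x_n) = c(x', x_n) · blockdiag(ĝ(x'), 1)` on `ℝ^{m+1}`. -/
def gMet {m : ℕ} (c : (Fin (m + 1) → ℝ) → ℝ)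
    (ghat : (Fin m → ℝ) → Matrix (Fin m) (Fin m) ℝ)
    (x : Fin (m + 1) → ℝ) : Matrix (Fin (m + 1)) (Fin (m + 1)) ℝ :=
  Matrix.of fun i j =>
    c x * (if hi : (i : ℕ) < m then
             (if hj : (j : ℕ) < m then ghat (proj x) ⟨i, hi⟩ ⟨j, hj⟩ else 0)
           else (if (j : ℕ) < m then 0 else 1))

/-- A function `u` on `ℝ^m`, regarded as a function on `ℝ^{m+1}` independent of the last
coordinate. -/
def ext {m : ℕ} (u : (Fin m → ℝ) → ℝ) (x : Fin (m + 1) → ℝ) : ℝ := u (proj x)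

/-- The quasilinear minimal surface operator
`F = (−Δ_ĝ u + ((1−n)/(2c)) ĝ^{mr} ∂_r c ∂_m u + ((n−1)/(2c)) ∂_n c)(1 + |∇_ĝ u|²_ĝ)
  + (∇²_ĝ u)(∇_ĝ u, ∇_ĝ u)`, where `n = m+1`, the spatial point is `x'` and the conformal
factor `c` and its derivatives are evaluated at the point `x ∈ ℝ^{m+1}`. -/
def Fop {m : ℕ} (c : (Fin (m + 1) → ℝ) → ℝ)
    (ghat : (Fin m → ℝ) → Matrix (Fin m) (Fin m) ℝ)
    (u : (Fin m → ℝ) → ℝ) (x' : Fin m → ℝ) (x : Fin (m + 1) → ℝ) : ℝ :=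
  (-(laplaceB ghat u x')
      + ((1 - ((m : ℝ) + 1)) / (2 * c x)) *
          ∑ mm : Fin m, ∑ r : Fin m, (ghat x')⁻¹ mm r * pd (Fin.castSucc r) c x * pd mm u x'
      + ((((m : ℝ) + 1) - 1) / (2 * c x)) * pd (Fin.last m) c x)
    * (1 + gradSq ghat u x')
  + ∑ i : Fin m, ∑ j : Fin m,
      hessian ghat u i j x' * gradC ghat u i x' * gradC ghat u j x'

lemma conf_christoffel {k : ℕ} (c : (Fin k → ℝ) → ℝ)
    (G : (Fin k → ℝ) → Matrix (Fin k) (Fin k) ℝ) (x : Fin k → ℝ)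
    (hc : DifferentiableAt ℝ c x) (hG : ∀ i j, DifferentiableAt ℝ (fun y => G y i j) x)
    (h0 : c x ≠ 0) (hdet : IsUnit (G x).det) (hsymm : ∀ i j, G x i j = G x j i)
    (a i j : Fin k) :
    christoffel (fun y => c y • G y) a i j x = christoffel G a i j x
      + 1 / (2 * c x) * ((if a = j then pd i c x else 0) + (if a = i then pd j c x else 0)
        - G x i j * ∑ l, (G x)⁻¹ a l * pd l c x) := by
  have hinv : (c x • G x)⁻¹ = (c x)⁻¹ • (G x)⁻¹ := by
    apply Matrix.inv_eq_right_inv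
    rw [Matrix.smul_mul, Matrix.mul_smul, smul_smul, mul_inv_cancel₀ h0, one_smul,
      Matrix.mul_nonsing_inv _ hdet]
  have hd : ∀ p i j : Fin k, pd p (fun y => (c y • G y) i j) x
      = c x * pd p (fun y => G y i j) x + pd p c x * G x i j := by
    intro p i j
    have : (fun y => (c y • G y) i j) = c * (fun y => G y i j) := by
      ext y; simp
    unfold pd
    rw [this, fderiv_mul hc (hG i j)]
    simp; ring
  have hone : ∀ j, ∑ l, (G x)⁻¹ a l * G x j l = if a = j then 1 else 0 := by
    intro j
    have := congrFun (congrFun (Matrix.nonsing_inv_mul _ hdet) a) j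
    rw [Matrix.mul_apply, Matrix.one_apply] at this
    rw [← this]
    exact Finset.sum_congr rfl fun l _ => by rw [hsymm j l]
  have key : ∀ D : Fin k → ℝ, ∑ l, (c x)⁻¹ * (G x)⁻¹ a l *
      (c x * D l + pd i c x * G x j l + pd j c x * G x i l - pd l c x * G x i j)
      = ∑ l, (G x)⁻¹ a l * D l + (c x)⁻¹ * (pd i c x * (∑ l, (G x)⁻¹ a l * G x j l)
        + pd j c x * (∑ l, (G x)⁻¹ a l * G x i l)
        - G x i j * ∑ l, (G x)⁻¹ a l * pd l c x) := by
    intro D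
    simp only [Finset.mul_sum, ← Finset.sum_add_distrib, ← Finset.sum_sub_distrib]
    refine Finset.sum_congr rfl fun l _ => ?_
    field_simp
    ring
  unfold christoffel
  simp only [hd]
  simp only [hinv, Matrix.smul_apply, smul_eq_mul]
  have := key (fun l => pd i (fun y => G y j l) x + pd j (fun y => G y i l) x
    - pd l (fun y => G y i j) x)
  rw [hone, hone] at this
  have e : ∀ l, (c x)⁻¹ * (G x)⁻¹ a l * (c x * pd i (fun y => G y j l) x + pd i c x * G x j l
     + (c x * pd j (fun y => G y i l) x + pd j c x * G x i l)
     - (c x * pd l (fun y => G y i j) x + pd l c x * G x i j)) =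
      (c x)⁻¹ * (G x)⁻¹ a l *
      (c x * (pd i (fun y => G y j l) x + pd j (fun y => G y i l) x
    - pd l (fun y => G y i j) x) + pd i c x * G x j l + pd j c x * G x i l - pd l c x * G x i j) := by
    intro l; ring
  rw [Finset.sum_congr rfl fun l _ => e l, this]
  simp only [mul_ite, mul_one, mul_zero]
  field_simp

lemma conf_total {k : ℕ} (c : (Fin k → ℝ) → ℝ)
    (G : (Fin k → ℝ) → Matrix (Fin k) (Fin k) ℝ) (x : Fin k → ℝ) (f : (Fin k → ℝ) → ℝ)
    (hc : DifferentiableAt ℝ c x) (hG : ∀ i j, DifferentiableAt ℝ (fun y => G y i j) x)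
    (h0 : c x ≠ 0) (hdet : IsUnit (G x).det) (hsymm : ∀ i j, G x i j = G x j i) :
    c x ^ 2 * (gradSq (fun y => c y • G y) f x * laplaceB (fun y => c y • G y) f x
      - ∑ i, ∑ j, hessian (fun y => c y • G y) f i j x
          * gradC (fun y => c y • G y) f i x * gradC (fun y => c y • G y) f j x)
    = gradSq G f x * (laplaceB G f x + ((k : ℝ) - 1) / (2 * c x) * ∑ l, pd l c x * gradC G f l x)
      - ∑ i, ∑ j, hessian G f i j x * gradC G f i x * gradC G f j x := by
  have hinv : (c x • G x)⁻¹ = (c x)⁻¹ • (G x)⁻¹ := by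
    apply Matrix.inv_eq_right_inv
    rw [Matrix.smul_mul, Matrix.mul_smul, smul_smul, mul_inv_cancel₀ h0, one_smul,
      Matrix.mul_nonsing_inv _ hdet]
  have hAs : ∀ i j, (G x)⁻¹ i j = (G x)⁻¹ j i := by
    intro i j
    have : (G x).transpose = G x := by ext i j; exact hsymm j i
    have h2 : ((G x)⁻¹).transpose = (G x)⁻¹ := by rw [Matrix.transpose_nonsing_inv, this]
    exact (congrFun (congrFun h2 i) j).symm
  have hAG : ∀ i j, ∑ l, (G x)⁻¹ i l * G x l j = if i = j then 1 else 0 := by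
    intro i j
    have := congrFun (congrFun (Matrix.nonsing_inv_mul _ hdet) i) j
    rwa [Matrix.mul_apply, Matrix.one_apply] at this
  have hGA : ∀ i j, ∑ l, G x i l * (G x)⁻¹ l j = if i = j then 1 else 0 := by
    intro i j
    have := congrFun (congrFun (Matrix.mul_nonsing_inv _ hdet) i) j
    rwa [Matrix.mul_apply, Matrix.one_apply] at this
  set W := ∑ l, pd l c x * gradC G f l x with hW
  set V := gradC G f with hV
  -- hessian
  have hhess : ∀ i j, hessian (fun y => c y • G y) f i j x = hessian G f i j x
      - 1 / (2 * c x) * (pd i c x * pd j f x + pd j c x * pd i f x - G x i j * W) := by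
    intro i j
    have hW2 : ∑ l, (∑ p, (G x)⁻¹ l p * pd p c x) * pd l f x = W := by
      rw [hW, hV]
      simp only [gradC, Finset.mul_sum, Finset.sum_mul]
      rw [Finset.sum_comm]
      refine Finset.sum_congr rfl fun p _ => Finset.sum_congr rfl fun l _ => ?_
      rw [hAs l p]; ring
    unfold hessian
    simp only [conf_christoffel c G x hc hG h0 hdet hsymm]
    have : ∀ l, (christoffel G l i j x + 1 / (2 * c x) * ((if l = j then pd i c x else 0)
        + (if l = i then pd j c x else 0) - G x i j * ∑ p, (G x)⁻¹ l p * pd p c x)) * pd l f x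
      = christoffel G l i j x * pd l f x + 1 / (2 * c x) * ((if l = j then pd i c x * pd l f x else 0)
        + (if l = i then pd j c x * pd l f x else 0)
        - G x i j * ((∑ p, (G x)⁻¹ l p * pd p c x) * pd l f x)) := by
      intro l
      split_ifs <;> ring
    rw [Finset.sum_congr rfl fun l _ => this l]
    rw [Finset.sum_add_distrib, ← Finset.mul_sum, Finset.sum_sub_distrib, Finset.sum_add_distrib,
      ← Finset.mul_sum, hW2]
    simp only [Finset.sum_ite_eq', Finset.mem_univ, if_true]
    ring
  have hgrad : ∀ i, gradC (fun y => c y • G y) f i x = (c x)⁻¹ * V i x := by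
    intro i
    rw [hV]
    simp only [gradC, hinv, Finset.mul_sum, Matrix.smul_apply, smul_eq_mul, mul_assoc]
  have hsq : gradSq (fun y => c y • G y) f x = (c x)⁻¹ * gradSq G f x := by
    simp only [gradSq, hinv, Finset.mul_sum, Matrix.smul_apply, smul_eq_mul, mul_assoc]
  have hlapdef : ∀ h : (Fin k → ℝ) → Matrix (Fin k) (Fin k) ℝ,
      laplaceB h f x = ∑ i, ∑ j, (h x)⁻¹ i j * hessian h f i j x := fun h => rfl
  have hS1 : ∑ i, pd i f x * V i x = gradSq G f x := by
    rw [hV]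
    simp only [gradC, gradSq, Finset.mul_sum]
    exact Finset.sum_congr rfl fun p _ => Finset.sum_congr rfl fun l _ => by ring
  have hT1 : ∑ i, ∑ j, (G x)⁻¹ i j * (pd i c x * pd j f x) = W := by
    rw [hW, hV]
    simp only [gradC, Finset.mul_sum]
    exact Finset.sum_congr rfl fun p _ => Finset.sum_congr rfl fun l _ => by ring
  have hT2 : ∑ i, ∑ j, (G x)⁻¹ i j * (pd j c x * pd i f x) = W := by
    rw [← hT1, Finset.sum_comm]
    exact Finset.sum_congr rfl fun p _ => Finset.sum_congr rfl fun l _ => by rw [hAs]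
  have hT3 : ∑ i, ∑ j, (G x)⁻¹ i j * G x i j = k := by
    have : ∀ i, ∑ j, (G x)⁻¹ i j * G x i j = 1 := by
      intro i
      rw [Finset.sum_congr rfl fun j _ => by rw [hsymm i j], hAG i i, if_pos rfl]
    simp [this]
  have hlap : laplaceB (fun y => c y • G y) f x
      = (c x)⁻¹ * (laplaceB G f x - 1 / (2 * c x) * (W + W - k * W)) := by
    rw [hlapdef, hlapdef]
    simp only [hinv, hhess, Matrix.smul_apply, smul_eq_mul]
    rw [← hT3]
    nth_rewrite 2 [← hT1]
    nth_rewrite 2 [← hT2]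
    simp only [Finset.mul_sum, Finset.sum_mul, ← Finset.sum_add_distrib, ← Finset.sum_sub_distrib]
    exact Finset.sum_congr rfl fun p _ => Finset.sum_congr rfl fun l _ => by ring
  have hGV : ∀ i, ∑ j, G x i j * V j x = pd i f x := by
    intro i
    rw [hV]
    simp only [gradC, Finset.mul_sum]
    rw [Finset.sum_comm]
    simp only [← mul_assoc, ← Finset.sum_mul, hGA]
    simp
  have hU1 : ∑ i, ∑ j, (pd i c x * pd j f x) * V i x * V j x = W * gradSq G f x := by
    rw [← hS1, hW, Finset.sum_mul_sum]
    exact Finset.sum_congr rfl fun p _ => Finset.sum_congr rfl fun l _ => by ring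
  have hU2 : ∑ i, ∑ j, (pd j c x * pd i f x) * V i x * V j x = W * gradSq G f x := by
    rw [← hU1, Finset.sum_comm]
    exact Finset.sum_congr rfl fun p _ => Finset.sum_congr rfl fun l _ => by ring
  have hU3 : ∑ i, ∑ j, G x i j * V i x * V j x = gradSq G f x := by
    rw [← hS1]
    refine Finset.sum_congr rfl fun p _ => ?_
    rw [← hGV, Finset.sum_mul]
    exact Finset.sum_congr rfl fun l _ => by ring
  have hHH : ∑ i, ∑ j, hessian (fun y => c y • G y) f i j x
          * gradC (fun y => c y • G y) f i x * gradC (fun y => c y • G y) f j x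
      = (c x)⁻¹ ^ 2 * (∑ i, ∑ j, hessian G f i j x * V i x * V j x
        - 1 / (2 * c x) * (∑ i, ∑ j, (pd i c x * pd j f x) * V i x * V j x
          + ∑ i, ∑ j, (pd j c x * pd i f x) * V i x * V j x
          - W * ∑ i, ∑ j, G x i j * V i x * V j x)) := by
    simp only [hhess, hgrad, Finset.mul_sum, ← Finset.sum_add_distrib, ← Finset.sum_sub_distrib]
    exact Finset.sum_congr rfl fun p _ => Finset.sum_congr rfl fun l _ => by ring
  rw [hHH, hU1, hU2, hU3, hlap, hsq]
  field_simp
  ring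

def projL (m : ℕ) : (Fin (m + 1) → ℝ) →L[ℝ] (Fin m → ℝ) :=
  ContinuousLinearMap.pi fun i => ContinuousLinearMap.proj (Fin.castSucc i)

lemma projL_eq {m : ℕ} (x : Fin (m + 1) → ℝ) : projL m x = proj x := rfl

lemma pd_proj {m : ℕ} (v : (Fin m → ℝ) → ℝ) (x : Fin (m + 1) → ℝ)
    (hv : DifferentiableAt ℝ v (proj x)) (p : Fin (m + 1)) :
    pd p (fun y => v (proj y)) x = fderiv ℝ v (proj x) (projL m (Pi.single p 1)) := by
  have h : HasFDerivAt (fun y => v (proj y)) ((fderiv ℝ v (proj x)).comp (projL m)) x :=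
    HasFDerivAt.comp x (f := fun y => proj y) hv.hasFDerivAt (projL m).hasFDerivAt
  unfold pd
  rw [h.fderiv]; rfl

lemma pd_proj_cs {m : ℕ} (v : (Fin m → ℝ) → ℝ) (x : Fin (m + 1) → ℝ)
    (hv : DifferentiableAt ℝ v (proj x)) (p : Fin m) :
    pd (Fin.castSucc p) (fun y => v (proj y)) x = pd p v (proj x) := by
  rw [pd_proj v x hv]
  have : projL m (Pi.single (Fin.castSucc p) 1) = Pi.single p 1 := by
    ext i
    simp [projL, Pi.single_apply]
  rw [this]; rfl

lemma pd_proj_last {m : ℕ} (v : (Fin m → ℝ) → ℝ) (x : Fin (m + 1) → ℝ)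
    (hv : DifferentiableAt ℝ v (proj x)) :
    pd (Fin.last m) (fun y => v (proj y)) x = 0 := by
  rw [pd_proj v x hv]
  have : projL m (Pi.single (Fin.last m) 1) = 0 := by
    ext i
    simp [projL, Pi.single_apply]
  rw [this]; simp

lemma pd_const {k : ℕ} (p : Fin k) (a : ℝ) (x : Fin k → ℝ) : pd p (fun _ => a) x = 0 := by
  simp [pd]

lemma pd_neg {k : ℕ} (p : Fin k) (v : (Fin k → ℝ) → ℝ) (x : Fin k → ℝ) :
    pd p (fun y => - v y) x = - pd p v x := by
  unfold pd
  rw [fderiv_fun_neg]; rfl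

def Gm {m : ℕ} (ghat : (Fin m → ℝ) → Matrix (Fin m) (Fin m) ℝ) :
    (Fin (m + 1) → ℝ) → Matrix (Fin (m + 1)) (Fin (m + 1)) ℝ := gMet (fun _ => 1) ghat

section block
variable {m : ℕ} (ghat : (Fin m → ℝ) → Matrix (Fin m) (Fin m) ℝ)

lemma Gm_cc (x : Fin (m + 1) → ℝ) (i j : Fin m) :
    Gm ghat x (Fin.castSucc i) (Fin.castSucc j) = ghat (proj x) i j := by
  simp [Gm, gMet]
lemma Gm_cl (x : Fin (m + 1) → ℝ) (i : Fin m) :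
    Gm ghat x (Fin.castSucc i) (Fin.last m) = 0 := by
  simp [Gm, gMet]
lemma Gm_lc (x : Fin (m + 1) → ℝ) (i : Fin m) :
    Gm ghat x (Fin.last m) (Fin.castSucc i) = 0 := by
  simp [Gm, gMet]
lemma Gm_ll (x : Fin (m + 1) → ℝ) :
    Gm ghat x (Fin.last m) (Fin.last m) = 1 := by
  simp [Gm, gMet]

lemma gMet_eq (c : (Fin (m + 1) → ℝ) → ℝ) : gMet c ghat = fun y => c y • Gm ghat y := by
  funext y; ext i j
  simp [Gm, gMet]

lemma Gm_mul (x : Fin (m + 1) → ℝ) (hdet : IsUnit (ghat (proj x)).det) :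
    Gm ghat x * Gm (fun y => (ghat y)⁻¹) x = 1 := by
  have h := Matrix.mul_nonsing_inv _ hdet
  ext i j
  rw [Matrix.mul_apply, Fin.sum_univ_castSucc]
  induction i using Fin.lastCases with
  | last =>
    induction j using Fin.lastCases with
    | last => simp [Gm_lc, Gm_ll]
    | cast j => simp [Gm_lc, Gm_ll, Matrix.one_apply, (Fin.castSucc_lt_last j).ne']
  | cast i =>
    induction j using Fin.lastCases with
    | last => simp [Gm_cl, Matrix.one_apply, (Fin.castSucc_lt_last i).ne]
    | cast j =>
      have h2 := congrFun (congrFun h i) j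
      rw [Matrix.mul_apply] at h2
      simp [Gm_cc, Gm_cl, h2, Matrix.one_apply]

lemma Gm_inv (x : Fin (m + 1) → ℝ) (hdet : IsUnit (ghat (proj x)).det) :
    (Gm ghat x)⁻¹ = Gm (fun y => (ghat y)⁻¹) x :=
  Matrix.inv_eq_right_inv (Gm_mul ghat x hdet)

variable (hg : ∀ i j, Differentiable ℝ (fun x' => ghat x' i j))
  (hdet : ∀ x', IsUnit (ghat x').det)
include hg hdet

lemma chr_ccc (x : Fin (m + 1) → ℝ) (a i j : Fin m) :
    christoffel (Gm ghat) (Fin.castSucc a) (Fin.castSucc i) (Fin.castSucc j) x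
      = christoffel ghat a i j (proj x) := by
  have h : ∀ p i j : Fin m, pd (Fin.castSucc p) (fun y => ghat (proj y) i j) x
      = pd p (fun y => ghat y i j) (proj x) :=
    fun p i j => pd_proj_cs (fun y => ghat y i j) x (hg i j _) p
  simp [christoffel, Fin.sum_univ_castSucc, Gm_inv ghat x (hdet _), Gm_cc, Gm_cl, h]

lemma chr_lcc (x : Fin (m + 1) → ℝ) (i j : Fin m) :
    christoffel (Gm ghat) (Fin.last m) (Fin.castSucc i) (Fin.castSucc j) x = 0 := by
  have h : ∀ i j : Fin m, pd (Fin.last m) (fun y => ghat (proj y) i j) x = 0 :=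
    fun i j => pd_proj_last (fun y => ghat y i j) x (hg i j _)
  simp [christoffel, Fin.sum_univ_castSucc, Gm_inv ghat x (hdet _), Gm_cc, Gm_cl, Gm_lc, h, pd_const]

lemma chr_cl (x : Fin (m + 1) → ℝ) (a i : Fin (m + 1)) :
    christoffel (Gm ghat) a i (Fin.last m) x = 0 := by
  have h : ∀ i j : Fin m, pd (Fin.last m) (fun y => ghat (proj y) i j) x = 0 :=
    fun i j => pd_proj_last (fun y => ghat y i j) x (hg i j _)
  induction i using Fin.lastCases <;>
  simp [christoffel, Fin.sum_univ_castSucc, Gm_cc, Gm_cl, Gm_lc, Gm_ll, h, pd_const]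

lemma chr_lc (x : Fin (m + 1) → ℝ) (a i : Fin (m + 1)) :
    christoffel (Gm ghat) a (Fin.last m) i x = 0 := by
  have h : ∀ i j : Fin m, pd (Fin.last m) (fun y => ghat (proj y) i j) x = 0 :=
    fun i j => pd_proj_last (fun y => ghat y i j) x (hg i j _)
  induction i using Fin.lastCases <;>
  simp [christoffel, Fin.sum_univ_castSucc, Gm_cc, Gm_cl, Gm_lc, Gm_ll, h, pd_const]

omit hg hdet
variable (u : (Fin m → ℝ) → ℝ) (hu : ContDiff ℝ 2 u)
include hu

lemma pdf_c (x : Fin (m + 1) → ℝ) (i : Fin m) :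
    pd (Fin.castSucc i) (fun y => y (Fin.last m) - ext u y) x = - pd i u (proj x) := by
  have hu1 : DifferentiableAt ℝ u (proj x) := (hu.differentiable (by norm_num)) _
  rw [← pd_proj_cs u x hu1]
  unfold pd ext
  have h2 : DifferentiableAt ℝ (fun y : Fin (m+1) → ℝ => u (proj y)) x :=
    DifferentiableAt.comp x (f := fun y => proj y) hu1 (projL m).differentiableAt
  have h1 : HasFDerivAt (fun y : Fin (m+1) → ℝ => y (Fin.last m))
    (ContinuousLinearMap.proj (R := ℝ) (φ := fun _ : Fin (m+1) => ℝ) (Fin.last m)) x :=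
    hasFDerivAt_apply _ _
  rw [(h1.fun_sub h2.hasFDerivAt).fderiv]
  simp [Pi.single_apply, (Fin.castSucc_lt_last i).ne']

lemma pdf_l (x : Fin (m + 1) → ℝ) :
    pd (Fin.last m) (fun y => y (Fin.last m) - ext u y) x = 1 := by
  have hu1 : DifferentiableAt ℝ u (proj x) := (hu.differentiable (by norm_num)) _
  have h3 := pd_proj_last u x hu1
  unfold pd ext at *
  have h2 : DifferentiableAt ℝ (fun y : Fin (m+1) → ℝ => u (proj y)) x :=
    DifferentiableAt.comp x (f := fun y => proj y) hu1 (projL m).differentiableAt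
  have h1 : HasFDerivAt (fun y : Fin (m+1) → ℝ => y (Fin.last m))
    (ContinuousLinearMap.proj (R := ℝ) (φ := fun _ : Fin (m+1) => ℝ) (Fin.last m)) x :=
    hasFDerivAt_apply _ _
  rw [(h1.fun_sub h2.hasFDerivAt).fderiv]
  simp [h3]

lemma pdu_diff (j : Fin m) : Differentiable ℝ (pd j u) := by
  have h : ContDiff ℝ 1 (fderiv ℝ u) := hu.fderiv_right (by norm_num)
  exact (h.differentiable (by norm_num)).clm_apply (differentiable_const _)

lemma pdf2_c (x : Fin (m + 1) → ℝ) (p : Fin (m + 1)) (j : Fin m) :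
    pd p (pd (Fin.castSucc j) (fun y => y (Fin.last m) - ext u y)) x
      = - pd p (fun y => pd j u (proj y)) x := by
  have : pd (Fin.castSucc j) (fun y => y (Fin.last m) - ext u y) = fun y => - pd j u (proj y) :=
    funext fun y => pdf_c u hu y j
  rw [this, pd_neg]

lemma pdf2_l (x : Fin (m + 1) → ℝ) (p : Fin (m + 1)) :
    pd p (pd (Fin.last m) (fun y => y (Fin.last m) - ext u y)) x = 0 := by
  have : pd (Fin.last m) (fun y => y (Fin.last m) - ext u y) = fun y => 1 :=
    funext fun y => pdf_l u hu y
  rw [this, pd_const]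

include hg hdet

lemma hess_cc (x : Fin (m + 1) → ℝ) (i j : Fin m) :
    hessian (Gm ghat) (fun y => y (Fin.last m) - ext u y) (Fin.castSucc i) (Fin.castSucc j) x
      = - hessian ghat u i j (proj x) := by
  unfold hessian
  rw [pdf2_c u hu, pd_proj_cs _ _ (pdu_diff u hu j _), Fin.sum_univ_castSucc]
  simp [chr_ccc ghat hg hdet, chr_lcc ghat hg hdet, pdf_c u hu]
  ring

lemma hess_lc (x : Fin (m + 1) → ℝ) (i : Fin (m + 1)) :
    hessian (Gm ghat) (fun y => y (Fin.last m) - ext u y) (Fin.last m) i x = 0 := by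
  unfold hessian
  induction i using Fin.lastCases with
  | last => simp [pdf2_l u hu, chr_lc ghat hg hdet]
  | cast j =>
    rw [pdf2_c u hu, pd_proj_last _ _ (pdu_diff u hu j _)]
    simp [chr_lc ghat hg hdet]

lemma hess_cl (x : Fin (m + 1) → ℝ) (i : Fin (m + 1)) :
    hessian (Gm ghat) (fun y => y (Fin.last m) - ext u y) i (Fin.last m) x = 0 := by
  unfold hessian
  simp [pdf2_l u hu, chr_cl ghat hg hdet]

omit hg

lemma grad_c (x : Fin (m + 1) → ℝ) (i : Fin m) :
    gradC (Gm ghat) (fun y => y (Fin.last m) - ext u y) (Fin.castSucc i) x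
      = - gradC ghat u i (proj x) := by
  simp [gradC, Fin.sum_univ_castSucc, Gm_inv ghat x (hdet _), Gm_cc, Gm_cl, pdf_c u hu]

lemma grad_l (x : Fin (m + 1) → ℝ) :
    gradC (Gm ghat) (fun y => y (Fin.last m) - ext u y) (Fin.last m) x = 1 := by
  simp [gradC, Fin.sum_univ_castSucc, Gm_inv ghat x (hdet _), Gm_lc, Gm_ll, pdf_l u hu]

lemma gradSq_G (x : Fin (m + 1) → ℝ) :
    gradSq (Gm ghat) (fun y => y (Fin.last m) - ext u y) x = 1 + gradSq ghat u (proj x) := by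
  simp [gradSq, Fin.sum_univ_castSucc, Gm_inv ghat x (hdet _), Gm_cc, Gm_cl, Gm_lc, Gm_ll,
    pdf_l u hu, pdf_c u hu]
  ring

include hg

lemma lap_G (x : Fin (m + 1) → ℝ) :
    laplaceB (Gm ghat) (fun y => y (Fin.last m) - ext u y) x = - laplaceB ghat u (proj x) := by
  have h : ∀ {k : ℕ} (h : (Fin k → ℝ) → Matrix (Fin k) (Fin k) ℝ) (f : (Fin k → ℝ) → ℝ)
    (x : Fin k → ℝ),
      laplaceB h f x = ∑ i, ∑ j, (h x)⁻¹ i j * hessian h f i j x := fun _ _ _ => rfl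
  rw [h, h]
  simp [Fin.sum_univ_castSucc, Gm_inv ghat x (hdet _), Gm_cc, hess_cc ghat hg hdet u hu,
    hess_lc ghat hg hdet u hu, hess_cl ghat hg hdet u hu]

lemma main_pt (hsymm : ∀ x' i j, ghat x' i j = ghat x' j i) (c : (Fin (m + 1) → ℝ) → ℝ)
    (hc : Differentiable ℝ c) (hcpos : ∀ x, 0 < c x) (x : Fin (m + 1) → ℝ) :
        c x ^ 2 *
            (gradSq (gMet c ghat) (fun y => y (Fin.last m) - ext u y) x
                * laplaceB (gMet c ghat) (fun y => y (Fin.last m) - ext u y) x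
              - ∑ i : Fin (m + 1), ∑ j : Fin (m + 1),
                  hessian (gMet c ghat) (fun y => y (Fin.last m) - ext u y) i j x
                    * gradC (gMet c ghat) (fun y => y (Fin.last m) - ext u y) i x
                    * gradC (gMet c ghat) (fun y => y (Fin.last m) - ext u y) j x)
          = Fop c ghat u (proj x) x := by
  have hGd : ∀ i j, DifferentiableAt ℝ (fun y => Gm ghat y i j) x := by
    intro i j
    induction i using Fin.lastCases with
    | last =>
      induction j using Fin.lastCases with
      | last => simp [Gm_ll]
      | cast j => simp [Gm_lc]
    | cast i =>
      induction j using Fin.lastCases with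
      | last => simp [Gm_cl]
      | cast j =>
        simp only [Gm_cc]
        exact DifferentiableAt.comp x (g := fun y => ghat y i j) (f := fun y => proj y)
          (hg i j _) (projL m).differentiableAt
  have hGs : ∀ i j, Gm ghat x i j = Gm ghat x j i := by
    intro i j
    induction i using Fin.lastCases with
    | last =>
      induction j using Fin.lastCases with
      | last => rfl
      | cast j => simp [Gm_lc, Gm_cl]
    | cast i =>
      induction j using Fin.lastCases with
      | last => simp [Gm_cl, Gm_lc]
      | cast j => simp only [Gm_cc]; exact hsymm _ _ _
  have hGdet : IsUnit (Gm ghat x).det := by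
    have := congrArg Matrix.det (Gm_mul ghat x (hdet _))
    rw [Matrix.det_mul, Matrix.det_one] at this
    exact IsUnit.of_mul_eq_one _ this
  have h0 : c x ≠ 0 := (hcpos x).ne'
  rw [gMet_eq, conf_total c (Gm ghat) x _ (hc x) hGd h0 hGdet hGs, gradSq_G ghat hdet u hu,
    lap_G ghat hg hdet u hu]
  simp only [Fin.sum_univ_castSucc, hess_cc ghat hg hdet u hu,
    hess_lc ghat hg hdet u hu, hess_cl ghat hg hdet u hu, grad_c ghat hdet u hu,
    grad_l ghat hdet u hu]
  have hAs : ∀ i j, (ghat (proj x))⁻¹ i j = (ghat (proj x))⁻¹ j i := by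
    intro i j
    have : (ghat (proj x)).transpose = ghat (proj x) := by ext i j; exact hsymm _ j i
    have h2 : ((ghat (proj x))⁻¹).transpose = (ghat (proj x))⁻¹ := by
      rw [Matrix.transpose_nonsing_inv, this]
    exact (congrFun (congrFun h2 i) j).symm
  have hS : ∑ mm : Fin m, ∑ r : Fin m, (ghat (proj x))⁻¹ mm r * pd (Fin.castSucc r) c x
      * pd mm u (proj x) = ∑ l : Fin m, pd (Fin.castSucc l) c x * gradC ghat u l (proj x) := by
    simp only [gradC, Finset.mul_sum]
    rw [Finset.sum_comm]
    refine Finset.sum_congr rfl fun p _ => Finset.sum_congr rfl fun l _ => ?_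
    rw [hAs l p]; ring
  unfold Fop
  rw [hS]
  push_cast
  simp only [mul_neg, neg_mul, Finset.sum_neg_distrib, neg_neg]
  simp
  ring

end block

/-- For `f(x', x_n) = x_n − u(x')`:
`c² (|∇_g f|²_g Δ_g f − (∇²_g f)(∇_g f, ∇_g f)) = F(x', u, ∇u, ∇²u)` pointwise, and hence
the graph of `u` over `Ω` is a minimal surface iff `u` satisfies the minimal surface
equation `F = 0` on `Ω` (with `c` evaluated at `(x', u(x'))`). -/
theorem graph_minimal_iff_mse (m : ℕ) (hm : 2 ≤ m)
    (ghat : (Fin m → ℝ) → Matrix (Fin m) (Fin m) ℝ)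
    (hghat : ∀ i j, ContDiff ℝ (⊤ : ℕ∞) fun x' => ghat x' i j)
    (hpd : ∀ x', (ghat x').PosDef)
    (c : (Fin (m + 1) → ℝ) → ℝ)
    (hc : ContDiff ℝ (⊤ : ℕ∞) c) (hcpos : ∀ x, 0 < c x)
    (u : (Fin m → ℝ) → ℝ) (hu : ContDiff ℝ 2 u) :
    (∀ x : Fin (m + 1) → ℝ,
        c x ^ 2 *
            (gradSq (gMet c ghat) (fun y => y (Fin.last m) - ext u y) x
                * laplaceB (gMet c ghat) (fun y => y (Fin.last m) - ext u y) x
              - ∑ i : Fin (m + 1), ∑ j : Fin (m + 1),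
                  hessian (gMet c ghat) (fun y => y (Fin.last m) - ext u y) i j x
                    * gradC (gMet c ghat) (fun y => y (Fin.last m) - ext u y) i x
                    * gradC (gMet c ghat) (fun y => y (Fin.last m) - ext u y) j x)
          = Fop c ghat u (proj x) x)
    ∧ (∀ Ω : Set (Fin m → ℝ),
        (∀ x' ∈ Ω,
            gradSq (gMet c ghat) (fun y => y (Fin.last m) - ext u y) (Fin.snoc x' (u x'))
                * laplaceB (gMet c ghat) (fun y => y (Fin.last m) - ext u y)
                    (Fin.snoc x' (u x'))
              - ∑ i : Fin (m + 1), ∑ j : Fin (m + 1),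
                  hessian (gMet c ghat) (fun y => y (Fin.last m) - ext u y) i j
                      (Fin.snoc x' (u x'))
                    * gradC (gMet c ghat) (fun y => y (Fin.last m) - ext u y) i
                        (Fin.snoc x' (u x'))
                    * gradC (gMet c ghat) (fun y => y (Fin.last m) - ext u y) j
                        (Fin.snoc x' (u x')) = 0)
          ↔ (∀ x' ∈ Ω, Fop c ghat u x' (Fin.snoc x' (u x')) = 0)) := by
  have hdet : ∀ x', IsUnit (ghat x').det := fun x' => (hpd x').det_pos.ne'.isUnit
  have hg : ∀ i j, Differentiable ℝ (fun x' => ghat x' i j) := fun i j =>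
    (hghat i j).differentiable (by simp)
  have hsymm : ∀ x' i j, ghat x' i j = ghat x' j i := fun x' i j => by
    simpa using ((hpd x').isHermitian.apply i j).symm
  have key := main_pt ghat hg hdet u hu hsymm c (hc.differentiable (by simp)) hcpos
  refine ⟨key, fun Ω => forall₂_congr fun x' _ => ?_⟩
  have hp : proj (Fin.snoc x' (u x') : Fin (m + 1) → ℝ) = x' := by
    funext i; simp [proj]
  have h := key (Fin.snoc x' (u x'))
  rw [hp] at h
  rw [← h, mul_eq_zero]
  have h0 : c (Fin.snoc x' (u x')) ^ 2 ≠ 0 := pow_ne_zero _ (hcpos _).ne'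
  simp only [h0, false_or]
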